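/- The function ρ^(A):[0,∞)×ℝ→ℝ defined by: for 0 ≤ t ≤ 1/2, ρ^(A)(t,x) = (x+2)/(2t+1) if x ∈ [−2, 2t−1], ρ^(A)(t,x) = 1 if x ∈ (2t−1, 0), ρ^(A)(t,x) = −1 if x ∈ (0, 1−2t), ρ^(A)(t,x) = (x−2)/(2t+1) if x ∈ [1−2t, 2], and ρ^(A)(t,x) = 0 otherwise; and for t > 1/2, ρ^(A)(t,x) = (x+2)/(2t+1) if x ∈ [−2, 0), ρ^(A)(t,x) = (x−2)/(2t+1) if x ∈ (0, 2], and ρ^(A)(t,x) = 0 otherwise, is a Kruzkov entropy solution of the Burgers equation ∂_t ρ + ∂_x(ρ²) = 0 with initial datum ρ̄^(A)(x) = (x+2)·1_{[−2,−1]}(x) + 1_{[−1,0]}(x) − 1_{[0,1]}(x) + (x−2)·1_{[1,2]}(x). -/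

import Mathlib

open MeasureTheory Set

/-- The explicit entropy admissible solution of Example A. -/
noncomputable def rhoA (t x : ℝ) : ℝ :=
  if t ≤ 1/2 then
    if x ∈ Icc (-2 : ℝ) (2*t - 1) then (x + 2) / (2*t + 1)
    else if x ∈ Ioo (2*t - 1) (0 : ℝ) then 1
    else if x ∈ Ioo (0 : ℝ) (1 - 2*t) then -1
    else if x ∈ Icc (1 - 2*t) (2 : ℝ) then (x - 2) / (2*t + 1)
    else 0
  else
    if x ∈ Ico (-2 : ℝ) 0 then (x + 2) / (2*t + 1)
    else if x ∈ Ioc (0 : ℝ) 2 then (x - 2) / (2*t + 1)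
    else 0

/-- The initial datum of Example A. -/
noncomputable def rhoA0 (x : ℝ) : ℝ :=
  (x + 2) * indicator (Icc (-2 : ℝ) (-1)) (fun _ => (1 : ℝ)) x
    + indicator (Icc (-1 : ℝ) 0) (fun _ => (1 : ℝ)) x
    - indicator (Icc (0 : ℝ) 1) (fun _ => (1 : ℝ)) x
    + (x - 2) * indicator (Icc (1 : ℝ) 2) (fun _ => (1 : ℝ)) x

/-- `ρ` is a Kruzkov entropy solution of the Burgers equation `∂_t ρ + ∂_x (ρ²) = 0`
with bounded measurable initial datum `ρ₀`. -/
def IsEntropySolBurgers (ρ : ℝ → ℝ → ℝ) (ρ₀ : ℝ → ℝ) : Prop :=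
  Measurable (Function.uncurry ρ) ∧ (∃ M, ∀ t x, |ρ t x| ≤ M) ∧
  Measurable ρ₀ ∧ (∃ M, ∀ x, |ρ₀ x| ≤ M) ∧
  (∀ φ : ℝ → ℝ → ℝ, ContDiff ℝ (⊤ : ℕ∞) (Function.uncurry φ) →
      HasCompactSupport (Function.uncurry φ) →
    (∫ t in Ioi (0:ℝ), ∫ x : ℝ,
        (ρ t x * deriv (fun s => φ s x) t + (ρ t x)^2 * deriv (fun y => φ t y) x))
      + (∫ x : ℝ, ρ₀ x * φ 0 x) = 0) ∧
  (∀ k : ℝ, ∀ φ : ℝ → ℝ → ℝ, ContDiff ℝ (⊤ : ℕ∞) (Function.uncurry φ) →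
      HasCompactSupport (Function.uncurry φ) → (∀ t x, 0 ≤ φ t x) →
    0 ≤ (∫ t in Ioi (0:ℝ), ∫ x : ℝ,
          (|ρ t x - k| * deriv (fun s => φ s x) t
            + Real.sign (ρ t x - k) * ((ρ t x)^2 - k^2) * deriv (fun y => φ t y) x))
        + (∫ x : ℝ, |ρ₀ x - k| * φ 0 x))


noncomputable def wA (t x : ℝ) : ℝ := max 0 (min 1 ((x + 2) / (2*t + 1)))

noncomputable def gA (e : ℝ → ℝ) (t x : ℝ) : ℝ :=
  if 0 ≤ t ∧ 0 < x + 2 ∧ x + 2 < 2*t+1 then e (wA t x) * (2*(x+2)/(2*t+1)^2) else 0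

lemma wA_nonneg (t x : ℝ) : 0 ≤ wA t x := le_max_left _ _
lemma wA_le (t x : ℝ) : wA t x ≤ 1 := max_le zero_le_one (min_le_left _ _)

lemma wA_meas : Measurable (Function.uncurry wA) := by
  unfold wA Function.uncurry
  fun_prop

lemma wA_eq_zero {t x : ℝ} (ht : 0 < 2*t+1) (hx : x + 2 ≤ 0) : wA t x = 0 := by
  unfold wA
  apply max_eq_left
  exact (min_le_right _ _).trans (div_nonpos_of_nonpos_of_nonneg hx ht.le)

lemma wA_eq_one {t x : ℝ} (ht : 0 < 2*t+1) (hx : 2*t+1 ≤ x + 2) : wA t x = 1 := by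
  unfold wA
  rw [min_eq_left ((one_le_div ht).2 hx)]
  norm_num

lemma wA_eq_mid {t x : ℝ} (ht : 0 < 2*t+1) (h0 : 0 ≤ x + 2) (hx : x + 2 ≤ 2*t+1) :
    wA t x = (x+2)/(2*t+1) := by
  unfold wA
  rw [min_eq_right ((div_le_one ht).2 hx), max_eq_right (by positivity)]

lemma gA_meas {e : ℝ → ℝ} (he : Measurable e) : Measurable (Function.uncurry (gA e)) := by
  unfold gA Function.uncurry
  refine Measurable.ite ?_ ?_ measurable_const
  · have h0 : MeasurableSet {p : ℝ × ℝ | 0 ≤ p.1} := measurableSet_le (by fun_prop) (by fun_prop)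
    have h1 : MeasurableSet {p : ℝ × ℝ | 0 < p.2 + 2} := measurableSet_lt (by fun_prop) (by fun_prop)
    have h2 : MeasurableSet {p : ℝ × ℝ | p.2 + 2 < 2 * p.1 + 1} :=
      measurableSet_lt (by fun_prop) (by fun_prop)
    exact h0.inter (h1.inter h2)
  · have := he.comp wA_meas
    apply Measurable.mul this
    fun_prop

lemma gA_bound {e : ℝ → ℝ} {C : ℝ} (hC : ∀ u, |e u| ≤ C) (t x : ℝ) :
    |gA e t x| ≤ C * 2 := by
  have hC0 : 0 ≤ C := (abs_nonneg _).trans (hC 0)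
  unfold gA
  split_ifs with h
  · rw [abs_mul]
    apply mul_le_mul (hC _) _ (abs_nonneg _) hC0
    have ht := h.1
    have hx := h.2.1
    have hy := h.2.2
    rw [abs_of_nonneg (by positivity), div_le_iff₀ (by positivity)]
    nlinarith
  · simpa using hC0

lemma wA_contT (x : ℝ) (B : ℝ) : ContinuousOn (fun t => wA t x) (Icc 0 B) := by
  unfold wA
  apply ContinuousOn.sup continuousOn_const
  apply ContinuousOn.inf continuousOn_const
  apply ContinuousOn.div (by fun_prop) (by fun_prop)
  intro t ht
  have := ht.1
  positivity

lemma wA_contX (t : ℝ) : Continuous (fun x => wA t x) := by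
  unfold wA
  fun_prop

open Filter Topology in
lemma wA_derivT {η e : ℝ → ℝ} {k : ℝ} (hd : ∀ u, u ≠ k → HasDerivAt η (e u) u)
    {t x : ℝ} (ht : 0 < t) (h1 : t ≠ (x+1)/2) (h2 : t ≠ ((x+2)/k-1)/2) :
    HasDerivAt (fun s => η (wA s x)) (- gA e t x) t := by
  have hpos : ∀ᶠ s in 𝓝 t, 0 < 2*s+1 := by
    filter_upwards [lt_mem_nhds ht] with s hs
    linarith
  have htp : 0 < 2*t+1 := by linarith
  rcases le_or_gt (x+2) 0 with hx | hx
  · have hg : gA e t x = 0 := by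
      unfold gA; rw [if_neg]; intro h; linarith [h.2.1]
    rw [hg, neg_zero]
    refine (hasDerivAt_const t (η 0)).congr_of_eventuallyEq ?_
    filter_upwards [hpos] with s hs
    rw [wA_eq_zero hs hx]
  rcases lt_trichotomy (x+2) (2*t+1) with h | h | h
  · have hw := wA_eq_mid htp hx.le h.le
    have hg : gA e t x = e ((x+2)/(2*t+1)) * (2*(x+2)/(2*t+1)^2) := by
      unfold gA; rw [if_pos ⟨ht.le, hx, h⟩, hw]
    have hk : (x+2)/(2*t+1) ≠ k := by
      intro hk
      apply h2
      rw [← hk]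
      field_simp
      ring
    have hd1 : HasDerivAt (fun s : ℝ => (x+2)/(2*s+1)) (-(2*(x+2)/(2*t+1)^2)) t := by
      have h3 : HasDerivAt (fun s : ℝ => 2*s+1) 2 t := by
        simpa using ((hasDerivAt_id t).const_mul 2).add_const 1
      have := (hasDerivAt_const t (x+2)).div h3 htp.ne'
      refine this.congr_deriv ?_
      ring
    have hd2 := HasDerivAt.comp t (hd _ hk) hd1
    rw [hg, ← mul_neg]
    refine hd2.congr_of_eventuallyEq ?_
    have : ∀ᶠ s in 𝓝 t, x+2 < 2*s+1 := by
      have h4 : (x+1)/2 < t := by linarith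
      filter_upwards [lt_mem_nhds h4] with s hs
      linarith
    filter_upwards [hpos, this] with s hs hs2
    rw [wA_eq_mid hs hx.le hs2.le]
    rfl
  · exact absurd (by linarith) h1
  · have hg : gA e t x = 0 := by
      unfold gA; rw [if_neg]; intro h; linarith [h.2.2]
    rw [hg, neg_zero]
    refine (hasDerivAt_const t (η 1)).congr_of_eventuallyEq ?_
    have h4 : t < (x+1)/2 := by linarith
    filter_upwards [hpos, gt_mem_nhds h4] with s hs hs2
    rw [wA_eq_one hs (by linarith)]

open Filter Topology in
lemma wA_derivX {q e : ℝ → ℝ} {k : ℝ} (hd : ∀ u, u ≠ k → HasDerivAt q (2 * u * e u) u)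
    {t x : ℝ} (ht : 0 ≤ t) (h1 : x ≠ -2) (h3 : x ≠ 2*t-1) (h2 : x ≠ k*(2*t+1)-2) :
    HasDerivAt (fun y => q (wA t y)) (gA e t x) x := by
  have htp : 0 < 2*t+1 := by linarith
  rcases lt_trichotomy x (-2) with hx | hx | hx
  · have hg : gA e t x = 0 := by
      unfold gA; rw [if_neg]; intro h; linarith [h.2.1]
    rw [hg]
    refine (hasDerivAt_const x (q 0)).congr_of_eventuallyEq ?_
    filter_upwards [gt_mem_nhds hx] with s hs
    rw [wA_eq_zero htp (by linarith)]
  · exact absurd hx h1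
  rcases lt_trichotomy x (2*t-1) with h | h | h
  · have hw := wA_eq_mid (x := x) htp (by linarith) (by linarith)
    have hg : gA e t x = e ((x+2)/(2*t+1)) * (2*(x+2)/(2*t+1)^2) := by
      unfold gA; rw [if_pos ⟨ht, by linarith, by linarith⟩, hw]
    have hk : (x+2)/(2*t+1) ≠ k := by
      intro hk
      apply h2
      rw [← hk]
      field_simp
      ring
    have hd1 : HasDerivAt (fun s : ℝ => (s+2)/(2*t+1)) (1/(2*t+1)) x :=
      ((hasDerivAt_id x).add_const 2).div_const _
    have hd2 := HasDerivAt.comp x (hd _ hk) hd1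
    have : gA e t x = 2 * ((x + 2) / (2 * t + 1)) * e ((x + 2) / (2 * t + 1)) * (1 / (2 * t + 1)) := by
      rw [hg]; field_simp
    rw [this]
    refine hd2.congr_of_eventuallyEq ?_
    filter_upwards [lt_mem_nhds hx, gt_mem_nhds h] with s hs hs2
    rw [wA_eq_mid htp (by linarith) (by linarith)]
    rfl
  · exact absurd h h3
  · have hg : gA e t x = 0 := by
      unfold gA; rw [if_neg]; intro h; linarith [h.2.2]
    rw [hg]
    refine (hasDerivAt_const x (q 1)).congr_of_eventuallyEq ?_
    filter_upwards [lt_mem_nhds h] with s hs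
    rw [wA_eq_one htp (by linarith)]


lemma int1 {f ψ : ℝ → ℝ} {C : ℝ} (hf : Measurable f) (hC : ∀ x, |f x| ≤ C) (hψ : Continuous ψ)
    (a b : ℝ) : IntervalIntegrable (fun x => f x * ψ x) volume a b := by
  have h := hψ.intervalIntegrable (μ := volume) a b
  rw [intervalIntegrable_iff] at h ⊢
  exact Integrable.bdd_mul h hf.aestronglyMeasurable (ae_of_all _ hC)

lemma int2 {f ψ : ℝ → ℝ → ℝ} {C : ℝ} (hf : Measurable (Function.uncurry f))
    (hC : ∀ t x, |f t x| ≤ C) (hψ : Continuous (Function.uncurry ψ)) (a b c d : ℝ) :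
    IntegrableOn (Function.uncurry fun t x => f t x * ψ t x) (uIoc a b ×ˢ uIoc c d) := by
  have h : IntegrableOn (Function.uncurry ψ) (uIoc a b ×ˢ uIoc c d) := by
    refine (hψ.continuousOn.integrableOn_compact
      (isCompact_uIcc.prod isCompact_uIcc : IsCompact (uIcc a b ×ˢ uIcc c d))).mono_set ?_
    exact prod_mono uIoc_subset_uIcc uIoc_subset_uIcc
  exact Integrable.bdd_mul h hf.aestronglyMeasurable (ae_of_all _ fun p => hC p.1 p.2)

lemma int21 {F : ℝ → ℝ → ℝ} {a b c d : ℝ}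
    (h : IntegrableOn (Function.uncurry F) (uIoc a b ×ˢ uIoc c d)) :
    IntervalIntegrable (fun t => ∫ x in c..d, F t x) volume a b := by
  rw [intervalIntegrable_iff]
  simp_rw [intervalIntegral.intervalIntegral_eq_integral_uIoc]
  rw [IntegrableOn, Measure.volume_eq_prod, ← Measure.prod_restrict] at h
  exact Integrable.smul (if c ≤ d then (1:ℝ) else -1) h.integral_prod_left

lemma comp_bound {η : ℝ → ℝ} (hη : Continuous η) : ∃ C, ∀ u ∈ Icc (-1:ℝ) 1, |η u| ≤ C :=
  isCompact_Icc.exists_bound_of_continuousOn hη.continuousOn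

lemma wA_mem (t x : ℝ) : wA t x ∈ Icc (-1:ℝ) 1 :=
  ⟨by linarith [wA_nonneg t x], wA_le t x⟩

lemma halfA {η q e : ℝ → ℝ} {k C : ℝ} (hη : Continuous η) (hq : Continuous q)
    (he : Measurable e) (hC : ∀ u, |e u| ≤ C)
    (hdη : ∀ u, u ≠ k → HasDerivAt η (e u) u)
    (hdq : ∀ u, u ≠ k → HasDerivAt q (2 * u * e u) u)
    {φ φt φx : ℝ → ℝ → ℝ} (hφ : Continuous (Function.uncurry φ))
    (hφt : Continuous (Function.uncurry φt)) (hφx : Continuous (Function.uncurry φx))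
    (hdt : ∀ t x, HasDerivAt (fun s => φ s x) (φt t x) t)
    (hdx : ∀ t x, HasDerivAt (fun y => φ t y) (φx t x) x)
    {B : ℝ} (hB : 0 < B) (hBt : ∀ x, φ B x = 0) (hBx : ∀ t, φ t (-B) = 0) :
    (∫ t in (0:ℝ)..B, ∫ x in (-B)..0, (η (wA t x) * φt t x + q (wA t x) * φx t x))
      = (∫ t in (0:ℝ)..B, q (wA t 0) * φ t 0) - ∫ x in (-B)..0, η (wA 0 x) * φ 0 x := by
  obtain ⟨Cη, hCη⟩ := comp_bound hη
  obtain ⟨Cq, hCq⟩ := comp_bound hq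
  have hmη : Measurable (Function.uncurry fun t x => η (wA t x)) := hη.measurable.comp wA_meas
  have hmq : Measurable (Function.uncurry fun t x => q (wA t x)) := hq.measurable.comp wA_meas
  have hbη : ∀ t x, |η (wA t x)| ≤ Cη := fun t x => hCη _ (wA_mem t x)
  have hbq : ∀ t x, |q (wA t x)| ≤ Cq := fun t x => hCq _ (wA_mem t x)
  have hmg := gA_meas he
  have hbg := gA_bound hC
  have sl1 : ∀ {f : ℝ → ℝ → ℝ}, Measurable (Function.uncurry f) → ∀ x, Measurable fun t => f t x :=
    fun h x => h.comp (measurable_id.prodMk measurable_const)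
  have sl2 : ∀ {f : ℝ → ℝ → ℝ}, Measurable (Function.uncurry f) → ∀ t, Measurable fun x => f t x :=
    fun h x => h.comp (measurable_const.prodMk measurable_id)
  have cl1 : ∀ {f : ℝ → ℝ → ℝ}, Continuous (Function.uncurry f) → ∀ x, Continuous fun t => f t x :=
    fun h x => h.comp (continuous_id.prodMk continuous_const)
  have cl2 : ∀ {f : ℝ → ℝ → ℝ}, Continuous (Function.uncurry f) → ∀ t, Continuous fun x => f t x :=
    fun h x => h.comp (continuous_const.prodMk continuous_id)
  -- the two one dimensional identities
  have T : ∀ x, (∫ t in (0:ℝ)..B, (-(gA e t x * φ t x) + η (wA t x) * φt t x))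
      = - (η (wA 0 x) * φ 0 x) := by
    intro x
    have := integral_eq_of_hasDerivAt_off_countable_of_le (fun t => η (wA t x) * φ t x)
      (fun t => -(gA e t x * φ t x) + η (wA t x) * φt t x) hB.le
      (s := {(x+1)/2, ((x+2)/k-1)/2}) (Set.toFinite _).countable
      ((hη.comp_continuousOn (wA_contT x B)).mul (cl1 hφ x).continuousOn) ?_ ?_
    · rw [this, hBt]; ring
    · rintro t ⟨ht, hs⟩
      simp only [mem_insert_iff, mem_singleton_iff, not_or] at hs
      have := (wA_derivT hdη ht.1 hs.1 hs.2).mul (hdt t x)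
      refine this.congr_deriv ?_
      ring
    · exact (int1 (sl1 hmg x) (fun t => hbg t x) (cl1 hφ x) _ _).neg.add
        (int1 (sl1 hmη x) (fun t => hbη t x) (cl1 hφt x) _ _)
  have X : ∀ t, 0 ≤ t → (∫ x in (-B)..0, (gA e t x * φ t x + q (wA t x) * φx t x))
      = q (wA t 0) * φ t 0 := by
    intro t ht
    have := integral_eq_of_hasDerivAt_off_countable_of_le (fun x => q (wA t x) * φ t x)
      (fun x => gA e t x * φ t x + q (wA t x) * φx t x) (by linarith : -B ≤ 0)
      (s := {-2, 2*t-1, k*(2*t+1)-2}) (Set.toFinite _).countable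
      ((hq.comp (wA_contX t)).mul (cl2 hφ t)).continuousOn ?_ ?_
    · rw [this, hBx]; ring
    · rintro x ⟨-, hs⟩
      simp only [mem_insert_iff, mem_singleton_iff, not_or] at hs
      exact (wA_derivX hdq ht hs.1 hs.2.1 hs.2.2).mul (hdx t x)
    · exact (int1 (sl2 hmg t) (fun x => hbg t x) (cl2 hφ t) _ _).add
        (int1 (sl2 hmq t) (fun x => hbq t x) (cl2 hφx t) _ _)
  have I1 : IntegrableOn (Function.uncurry fun t x => -(gA e t x * φ t x) + η (wA t x) * φt t x)
      (uIoc 0 B ×ˢ uIoc (-B) 0) :=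
    (int2 hmg hbg hφ _ _ _ _).neg.add (int2 hmη hbη hφt _ _ _ _)
  have I2 : IntegrableOn (Function.uncurry fun t x => gA e t x * φ t x + q (wA t x) * φx t x)
      (uIoc 0 B ×ˢ uIoc (-B) 0) :=
    (int2 hmg hbg hφ _ _ _ _).add (int2 hmq hbq hφx _ _ _ _)
  have key : ∀ t, (∫ x in (-B)..0, (η (wA t x) * φt t x + q (wA t x) * φx t x))
      = (∫ x in (-B)..0, (-(gA e t x * φ t x) + η (wA t x) * φt t x))
        + ∫ x in (-B)..0, (gA e t x * φ t x + q (wA t x) * φx t x) := by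
    intro t
    rw [← intervalIntegral.integral_add]
    · congr 1; ext x; ring
    · exact (int1 (sl2 hmg t) (fun x => hbg t x) (cl2 hφ t) _ _).neg.add
        (int1 (sl2 hmη t) (fun x => hbη t x) (cl2 hφt t) _ _)
    · exact (int1 (sl2 hmg t) (fun x => hbg t x) (cl2 hφ t) _ _).add
        (int1 (sl2 hmq t) (fun x => hbq t x) (cl2 hφx t) _ _)
  simp_rw [key]
  rw [intervalIntegral.integral_add (int21 I1) (int21 I2),
    intervalIntegral_intervalIntegral_swap I1]
  simp_rw [T]
  rw [intervalIntegral.integral_neg]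
  have : (∫ t in (0:ℝ)..B, ∫ x in (-B)..0, (gA e t x * φ t x + q (wA t x) * φx t x))
      = ∫ t in (0:ℝ)..B, q (wA t 0) * φ t 0 := by
    apply intervalIntegral.integral_congr
    intro t ht
    rw [uIcc_of_le hB.le] at ht
    exact X t ht.1
  rw [this]
  ring

lemma rhoA_neg {t x : ℝ} (ht : 0 ≤ t) (hx : x < 0) : rhoA t x = wA t x := by
  have htp : 0 < 2*t+1 := by linarith
  unfold rhoA
  simp only [mem_Icc, mem_Ioo, mem_Ico, mem_Ioc]
  rcases lt_or_ge x (-2) with h | h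
  · rw [wA_eq_zero htp (by linarith)]
    split_ifs <;> first | rfl | (exfalso; grind)
  rcases le_or_gt x (2*t-1) with h2 | h2
  · rw [wA_eq_mid htp (by linarith) (by linarith)]
    split_ifs <;> first | rfl | (exfalso; grind)
  · rw [wA_eq_one htp (by linarith)]
    split_ifs <;> first | rfl | (exfalso; grind)

lemma rhoA_pos {t x : ℝ} (ht : 0 ≤ t) (hx : 0 < x) : rhoA t x = - wA t (-x) := by
  have htp : 0 < 2*t+1 := by linarith
  unfold rhoA
  simp only [mem_Icc, mem_Ioo, mem_Ico, mem_Ioc]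
  rcases lt_or_ge 2 x with h | h
  · rw [wA_eq_zero htp (by linarith)]
    split_ifs <;> first | (exfalso; grind) | norm_num
  rcases le_or_gt (1-2*t) x with h2 | h2
  · rw [wA_eq_mid htp (by linarith) (by linarith)]
    split_ifs <;> first | (exfalso; grind) | (rw [← neg_div]; congr 1; ring)
  · rw [wA_eq_one htp (by linarith)]
    split_ifs <;> first | rfl | (exfalso; grind)

lemma rhoA_bound (t x : ℝ) : |rhoA t x| ≤ 1 := by
  unfold rhoA
  simp only [mem_Icc, mem_Ioo, mem_Ico, mem_Ioc]
  have a1 : ∀ a b : ℝ, |a| ≤ b → |a / b| ≤ 1 := by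
    intro a b h
    have hb : 0 ≤ b := (abs_nonneg _).trans h
    rw [abs_div, abs_of_nonneg hb]
    exact div_le_one_of_le₀ h hb
  split_ifs <;> first | norm_num; done | (apply a1; rw [abs_le]; constructor <;> grind)

lemma rhoA_meas : Measurable (Function.uncurry rhoA) := by
  unfold rhoA Function.uncurry
  simp only [mem_Icc, mem_Ioo, mem_Ico, mem_Ioc]
  have ml : ∀ {f g : ℝ × ℝ → ℝ}, Measurable f → Measurable g → MeasurableSet {p | f p ≤ g p} :=
    fun hf hg => measurableSet_le hf hg
  have mt : ∀ {f g : ℝ × ℝ → ℝ}, Measurable f → Measurable g → MeasurableSet {p | f p < g p} :=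
    fun hf hg => measurableSet_lt hf hg
  refine Measurable.ite (ml (by fun_prop) (by fun_prop)) ?_ ?_
  · refine Measurable.ite ((ml (f := fun _ => -2) (g := fun p => p.2) (by fun_prop)
      (by fun_prop)).inter (ml (f := fun p => p.2) (g := fun p => 2 * p.1 - 1) (by fun_prop)
      (by fun_prop))) (by fun_prop) ?_
    refine Measurable.ite ((mt (f := fun p => 2 * p.1 - 1) (g := fun p => p.2) (by fun_prop)
      (by fun_prop)).inter (mt (f := fun p => p.2) (g := fun p => 0) (by fun_prop)
      (by fun_prop))) (by fun_prop) ?_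
    refine Measurable.ite ((mt (f := fun p => 0) (g := fun p => p.2) (by fun_prop)
      (by fun_prop)).inter (mt (f := fun p => p.2) (g := fun p => 1 - 2 * p.1) (by fun_prop)
      (by fun_prop))) (by fun_prop) ?_
    exact Measurable.ite ((ml (f := fun p => 1 - 2 * p.1) (g := fun p => p.2) (by fun_prop)
      (by fun_prop)).inter (ml (f := fun p => p.2) (g := fun p => 2) (by fun_prop)
      (by fun_prop))) (by fun_prop) (by fun_prop)
  · refine Measurable.ite ((ml (f := fun _ => -2) (g := fun p => p.2) (by fun_prop)
      (by fun_prop)).inter (mt (f := fun p => p.2) (g := fun p => 0) (by fun_prop)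
      (by fun_prop))) (by fun_prop) ?_
    exact Measurable.ite ((mt (f := fun p => 0) (g := fun p => p.2) (by fun_prop)
      (by fun_prop)).inter (ml (f := fun p => p.2) (g := fun p => 2) (by fun_prop)
      (by fun_prop))) (by fun_prop) (by fun_prop)

lemma rhoA0_eq {x : ℝ} (h1 : x ≠ -1) (h2 : x ≠ 0) (h3 : x ≠ 1) : rhoA0 x = rhoA 0 x := by
  unfold rhoA0 rhoA
  simp only [indicator, mem_Icc, mem_Ioo, mem_Ico, mem_Ioc]
  split_ifs <;> grind

lemma rhoA0_meas : Measurable rhoA0 := by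
  unfold rhoA0
  have : ∀ a b : ℝ, Measurable (indicator (Icc a b) (fun _ => (1:ℝ))) := fun a b =>
    measurable_const.indicator measurableSet_Icc
  exact ((((by fun_prop : Measurable fun x : ℝ => x + 2).mul (this _ _)).add (this _ _)).sub
    (this _ _)).add ((by fun_prop : Measurable fun x : ℝ => x - 2).mul (this _ _))

lemma rhoA0_bound (x : ℝ) : |rhoA0 x| ≤ 2 := by
  unfold rhoA0
  simp only [indicator, mem_Icc]
  rw [abs_le]
  split_ifs <;> constructor <;> grind

lemma fullA {η q e : ℝ → ℝ} {k C : ℝ} (hη : Continuous η) (hq : Continuous q)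
    (he : Measurable e) (hC : ∀ u, |e u| ≤ C)
    (hdη : ∀ u, u ≠ k → HasDerivAt η (e u) u)
    (hdq : ∀ u, u ≠ k → HasDerivAt q (2 * u * e u) u)
    {φ : ℝ → ℝ → ℝ} (hs : ContDiff ℝ (⊤ : ℕ∞) (Function.uncurry φ))
    (hc : HasCompactSupport (Function.uncurry φ)) :
    ∃ B, 0 < B ∧ (∫ t in Ioi (0:ℝ), ∫ x : ℝ,
        (η (rhoA t x) * deriv (fun s => φ s x) t + q (rhoA t x) * deriv (fun y => φ t y) x))
      + (∫ x : ℝ, η (rhoA0 x) * φ 0 x)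
      = ∫ t in (0:ℝ)..B, (q (wA t 0) - q (- wA t 0)) * φ t 0 := by
  -- derivatives of the test function
  have hdiff : Differentiable ℝ (Function.uncurry φ) := hs.differentiable (by simp)
  have hcf : Continuous (fderiv ℝ (Function.uncurry φ)) := hs.continuous_fderiv (by simp)
  have hdt' : ∀ t x, HasDerivAt (fun s => φ s x) (fderiv ℝ (Function.uncurry φ) (t, x) (1, 0)) t := by
    intro t x
    exact (hdiff (t, x)).hasFDerivAt.comp_hasDerivAt t
      ((hasDerivAt_id t).prodMk (hasDerivAt_const t x))
  have hdx' : ∀ t x, HasDerivAt (fun y => φ t y) (fderiv ℝ (Function.uncurry φ) (t, x) (0, 1)) x := by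
    intro t x
    exact (hdiff (t, x)).hasFDerivAt.comp_hasDerivAt x
      ((hasDerivAt_const x t).prodMk (hasDerivAt_id x))
  obtain ⟨φt, hφt⟩ : ∃ f : ℝ → ℝ → ℝ, f = fun t x => deriv (fun s => φ s x) t := ⟨_, rfl⟩
  obtain ⟨φx, hφx⟩ : ∃ f : ℝ → ℝ → ℝ, f = fun t x => deriv (fun y => φ t y) x := ⟨_, rfl⟩
  have hdt : ∀ t x, HasDerivAt (fun s => φ s x) (φt t x) t := by
    intro t x; rw [hφt]; exact (hdt' t x).differentiableAt.hasDerivAt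
  have hdx : ∀ t x, HasDerivAt (fun y => φ t y) (φx t x) x := by
    intro t x; rw [hφx]; exact (hdx' t x).differentiableAt.hasDerivAt
  have hct : Continuous (Function.uncurry φt) := by
    have : Function.uncurry φt = fun p => fderiv ℝ (Function.uncurry φ) p (1, 0) := by
      ext ⟨t, x⟩; exact (hdt t x).unique (hdt' t x)
    rw [this]; exact hcf.clm_apply continuous_const
  have hcx : Continuous (Function.uncurry φx) := by
    have : Function.uncurry φx = fun p => fderiv ℝ (Function.uncurry φ) p (0, 1) := by
      ext ⟨t, x⟩; exact (hdx t x).unique (hdx' t x)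
    rw [this]; exact hcf.clm_apply continuous_const
  have hcφ := hs.continuous
  -- the box
  obtain ⟨R, hR⟩ := hc.isCompact.isBounded.subset_closedBall (0 : ℝ × ℝ)
  have hz : ∀ t x, (R < |t| ∨ R < |x|) → φ t x = 0 := by
    intro t x h
    by_contra hne
    have h1 : (t, x) ∈ tsupport (Function.uncurry φ) := subset_tsupport _ hne
    have h2 := hR h1
    rw [mem_closedBall_zero_iff, Prod.norm_mk, sup_le_iff, Real.norm_eq_abs, Real.norm_eq_abs] at h2
    rcases h with h | h <;> linarith [h2.1, h2.2]
  obtain ⟨B, hB, hRB⟩ : ∃ B : ℝ, 0 < B ∧ R < B :=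
    ⟨max R 0 + 1, by positivity, by linarith [le_max_left R 0]⟩
  have hzt : ∀ t x, (B ≤ |t| ∨ B ≤ |x|) → φt t x = 0 := by
    intro t x h
    refine (hdt t x).unique ?_
    rcases h with h | h
    · refine (hasDerivAt_const t 0).congr_of_eventuallyEq ?_
      filter_upwards [continuous_abs.continuousAt.eventually (lt_mem_nhds (hRB.trans_le h))] with s hs
      exact hz s x (Or.inl hs)
    · refine (hasDerivAt_const t 0).congr_of_eventuallyEq (Filter.Eventually.of_forall ?_)
      intro s
      exact hz s x (Or.inr (hRB.trans_le h))
  have hzx : ∀ t x, (B ≤ |t| ∨ B ≤ |x|) → φx t x = 0 := by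
    intro t x h
    refine (hdx t x).unique ?_
    rcases h with h | h
    · refine (hasDerivAt_const x 0).congr_of_eventuallyEq (Filter.Eventually.of_forall ?_)
      intro s
      exact hz t s (Or.inl (hRB.trans_le h))
    · refine (hasDerivAt_const x 0).congr_of_eventuallyEq ?_
      filter_upwards [continuous_abs.continuousAt.eventually (lt_mem_nhds (hRB.trans_le h))] with s hs
      exact hz t s (Or.inr hs)
  have hz' : ∀ t x, (B ≤ |t| ∨ B ≤ |x|) → φ t x = 0 := fun t x h =>
    hz t x (h.imp hRB.trans_le hRB.trans_le)
  refine ⟨B, hB, ?_⟩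
  have hBa : |B| = B := abs_of_pos hB
  have hBn : |-B| = B := by rw [abs_neg, hBa]
  -- the two halves
  have L := halfA hη hq he hC hdη hdq hcφ hct hcx hdt hdx hB
    (fun x => hz' B x (Or.inl hBa.ge)) (fun t => hz' t (-B) (Or.inr hBn.ge))
  have hr : Continuous fun p : ℝ × ℝ => (p.1, -p.2) := by fun_prop
  have Rt := halfA (η := fun u => η (-u)) (q := fun u => - q (-u)) (e := fun u => - e (-u))
    (k := -k) (C := C) (hη.comp continuous_neg) (hq.comp continuous_neg).neg
    (he.comp measurable_neg).neg (fun u => by rw [abs_neg]; exact hC _)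
    (fun u hu => by
      have := (hdη (-u) (fun h => hu (by linarith))).comp u (hasDerivAt_neg u)
      exact this.congr_deriv (by ring))
    (fun u hu => by
      have := ((hdq (-u) (fun h => hu (by linarith))).comp u (hasDerivAt_neg u)).neg
      exact this.congr_deriv (by ring))
    (φ := fun t x => φ t (-x)) (φt := fun t x => φt t (-x)) (φx := fun t x => - φx t (-x))
    (hcφ.comp hr) (hct.comp hr) (hcx.comp hr).neg
    (fun t x => hdt t (-x))
    (fun t x => by
      have := (hdx t (-x)).comp x (hasDerivAt_neg x)
      exact this.congr_deriv (by ring))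
    hB (fun x => hz' B (-x) (Or.inl hBa.ge)) (fun t => hz' t (- -B) (Or.inr (by simp [hBa])))
  simp only [neg_zero, neg_mul_neg] at Rt
  -- bounds
  obtain ⟨Cη, hCη⟩ := comp_bound hη
  obtain ⟨Cq, hCq⟩ := comp_bound hq
  have sl2 : ∀ {f : ℝ → ℝ → ℝ}, Measurable (Function.uncurry f) → ∀ t, Measurable fun x => f t x :=
    fun h x => h.comp (measurable_const.prodMk measurable_id)
  have cl2 : ∀ {f : ℝ → ℝ → ℝ}, Continuous (Function.uncurry f) → ∀ t, Continuous fun x => f t x :=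
    fun h x => h.comp (continuous_const.prodMk continuous_id)
  have cl1 : ∀ {f : ℝ → ℝ → ℝ}, Continuous (Function.uncurry f) → ∀ x, Continuous fun t => f t x :=
    fun h x => h.comp (continuous_id.prodMk continuous_const)
  have hrm : ∀ t x, rhoA t x ∈ Icc (-1:ℝ) 1 := fun t x => abs_le.1 (rhoA_bound t x)
  have hwm' : ∀ t x, - wA t x ∈ Icc (-1:ℝ) 1 := fun t x =>
    ⟨by linarith [wA_le t x], by linarith [wA_nonneg t x]⟩
  have ne0 : ∀ᵐ x : ℝ, x ≠ 0 := by
    simpa using (Set.countable_singleton (0:ℝ)).ae_notMem volume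
  -- reduction of the line integral to the left half line
  have split : ∀ F : ℝ → ℝ, (∀ x, B ≤ |x| → F x = 0) → (∀ a b, IntervalIntegrable F volume a b) →
      (∫ x, F x) = (∫ x in (-B)..0, F x) + ∫ x in (-B)..0, F (-x) := by
    intro F hF hI
    rw [intervalIntegral.integral_comp_neg]
    simp only [neg_zero, neg_neg]
    rw [intervalIntegral.integral_add_adjacent_intervals (hI _ _) (hI _ _),
      intervalIntegral.integral_of_le (by linarith),
      setIntegral_eq_integral_of_forall_compl_eq_zero]
    intro x hx
    apply hF
    by_contra hlt
    push Not at hlt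
    have := abs_lt.1 hlt
    exact hx ⟨this.1, this.2.le⟩
  have IL := int21 (F := fun t x => η (wA t x) * φt t x + q (wA t x) * φx t x)
    (a := 0) (b := B) (c := -B) (d := 0)
    ((int2 (f := fun t x => η (wA t x)) (hη.measurable.comp wA_meas) (fun t x => hCη _ (wA_mem t x))
      hct _ _ _ _).add
     (int2 (f := fun t x => q (wA t x)) (hq.measurable.comp wA_meas) (fun t x => hCq _ (wA_mem t x))
      hcx _ _ _ _))
  have IR := int21 (F := fun t x => η (-wA t x) * φt t (-x) + q (-wA t x) * φx t (-x))
    (a := 0) (b := B) (c := -B) (d := 0)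
    ((int2 (f := fun t x => η (-wA t x)) (ψ := fun t x => φt t (-x))
      (hη.measurable.comp wA_meas.neg) (fun t x => hCη _ (hwm' t x)) (hct.comp hr) _ _ _ _).add
     (int2 (f := fun t x => q (-wA t x)) (ψ := fun t x => φx t (-x))
      (hq.measurable.comp wA_meas.neg) (fun t x => hCq _ (hwm' t x)) (hcx.comp hr) _ _ _ _))
  have inner : ∀ t, 0 ≤ t → (∫ x : ℝ, (η (rhoA t x) * φt t x + q (rhoA t x) * φx t x))
      = (∫ x in (-B)..0, (η (wA t x) * φt t x + q (wA t x) * φx t x))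
        + ∫ x in (-B)..0, (η (-wA t x) * φt t (-x) + q (-wA t x) * φx t (-x)) := by
    intro t ht
    rw [split]
    · congr 1
      · apply intervalIntegral.integral_congr_ae
        filter_upwards [ne0] with x hx hm
        rw [uIoc_of_le (by linarith)] at hm
        rw [rhoA_neg ht (lt_of_le_of_ne hm.2 hx)]
      · apply intervalIntegral.integral_congr_ae
        filter_upwards [ne0] with x hx hm
        rw [uIoc_of_le (by linarith)] at hm
        have := lt_of_le_of_ne hm.2 hx
        rw [rhoA_pos ht (by linarith : 0 < -x), neg_neg]
    · intro x hx
      rw [hzt t x (Or.inr hx), hzx t x (Or.inr hx)]; ring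
    · intro a b
      exact (int1 (f := fun x => η (rhoA t x)) (hη.measurable.comp (sl2 rhoA_meas t))
        (fun x => hCη _ (hrm t x)) (cl2 hct t) _ _).add
        (int1 (f := fun x => q (rhoA t x)) (hq.measurable.comp (sl2 rhoA_meas t))
        (fun x => hCq _ (hrm t x)) (cl2 hcx t) _ _)
  have hinit : (∫ x : ℝ, η (rhoA0 x) * φ 0 x) = (∫ x in (-B)..0, η (wA 0 x) * φ 0 x)
      + ∫ x in (-B)..0, η (-wA 0 x) * φ 0 (-x) := by
    have e1 : (∫ x : ℝ, η (rhoA0 x) * φ 0 x) = ∫ x : ℝ, η (rhoA 0 x) * φ 0 x := by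
      apply integral_congr_ae
      filter_upwards [(Set.toFinite ({-1, 0, 1} : Set ℝ)).countable.ae_notMem volume] with x hx
      simp only [mem_insert_iff, mem_singleton_iff, not_or] at hx
      rw [rhoA0_eq hx.1 hx.2.1 hx.2.2]
    rw [e1, split]
    · congr 1
      · apply intervalIntegral.integral_congr_ae
        filter_upwards [ne0] with x hx hm
        rw [uIoc_of_le (by linarith)] at hm
        rw [rhoA_neg le_rfl (lt_of_le_of_ne hm.2 hx)]
      · apply intervalIntegral.integral_congr_ae
        filter_upwards [ne0] with x hx hm
        rw [uIoc_of_le (by linarith)] at hm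
        have := lt_of_le_of_ne hm.2 hx
        rw [rhoA_pos le_rfl (by linarith : 0 < -x), neg_neg]
    · intro x hx
      rw [hz' 0 x (Or.inr hx)]; ring
    · intro a b
      exact int1 (f := fun x => η (rhoA 0 x)) (hη.measurable.comp (sl2 rhoA_meas 0))
        (fun x => hCη _ (hrm 0 x)) (cl2 hcφ 0) _ _
  have outer : (∫ t in Ioi (0:ℝ), ∫ x : ℝ, (η (rhoA t x) * φt t x + q (rhoA t x) * φx t x))
      = (∫ t in (0:ℝ)..B, ∫ x in (-B)..0, (η (wA t x) * φt t x + q (wA t x) * φx t x))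
        + ∫ t in (0:ℝ)..B, ∫ x in (-B)..0, (η (-wA t x) * φt t (-x) + q (-wA t x) * φx t (-x)) := by
    rw [← intervalIntegral.integral_add IL IR]
    have e1 : (∫ t in (0:ℝ)..B, ((∫ x in (-B)..0, (η (wA t x) * φt t x + q (wA t x) * φx t x))
        + ∫ x in (-B)..0, (η (-wA t x) * φt t (-x) + q (-wA t x) * φx t (-x))))
        = ∫ t in (0:ℝ)..B, ∫ x : ℝ, (η (rhoA t x) * φt t x + q (rhoA t x) * φx t x) := by
      apply intervalIntegral.integral_congr
      intro t ht
      rw [uIcc_of_le hB.le] at ht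
      exact (inner t ht.1).symm
    rw [e1, intervalIntegral.integral_of_le hB.le]
    apply setIntegral_eq_of_subset_of_forall_sdiff_eq_zero measurableSet_Ioi Ioc_subset_Ioi_self
    rintro t ⟨ht, hn⟩
    have hBt : B ≤ |t| := by
      have h0 : (0:ℝ) < t := ht
      rw [abs_of_pos h0]
      by_contra hlt
      exact hn ⟨h0, (not_le.1 hlt).le⟩
    simp [hzt t _ (Or.inl hBt), hzx t _ (Or.inl hBt)]
  have hw0 : ∀ t, wA t 0 ∈ Icc (-1:ℝ) 1 := fun t => wA_mem t 0
  have hmw : Measurable fun t => wA t 0 := wA_meas.comp (measurable_id.prodMk measurable_const)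
  have J1 : IntervalIntegrable (fun t => q (wA t 0) * φ t 0) volume 0 B :=
    int1 (f := fun t => q (wA t 0)) (hq.measurable.comp hmw) (fun t => hCq _ (wA_mem t 0))
      (cl1 hcφ 0) _ _
  have J2 : IntervalIntegrable (fun t => q (-wA t 0) * φ t 0) volume 0 B :=
    int1 (f := fun t => q (-wA t 0)) (hq.measurable.comp hmw.neg) (fun t => hCq _ (hwm' t 0))
      (cl1 hcφ 0) _ _
  have e2 : (∫ t in (0:ℝ)..B, (q (wA t 0) - q (- wA t 0)) * φ t 0)
      = (∫ t in (0:ℝ)..B, q (wA t 0) * φ t 0) - ∫ t in (0:ℝ)..B, q (-wA t 0) * φ t 0 := by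
    rw [← intervalIntegral.integral_sub J1 J2]
    congr 1; ext t; ring
  have e3 : (∫ t in (0:ℝ)..B, -q (-wA t 0) * φ t 0) = - ∫ t in (0:ℝ)..B, q (-wA t 0) * φ t 0 := by
    rw [← intervalIntegral.integral_neg]
    congr 1; ext t; ring
  rw [e3] at Rt
  have goal' : (∫ t in Ioi (0:ℝ), ∫ x : ℝ, (η (rhoA t x) * φt t x + q (rhoA t x) * φx t x))
      + (∫ x : ℝ, η (rhoA0 x) * φ 0 x)
      = ∫ t in (0:ℝ)..B, (q (wA t 0) - q (- wA t 0)) * φ t 0 := by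
    rw [outer, hinit, L, Rt, e2]
    ring
  rw [hφt, hφx] at goal'
  exact goal'

lemma sign_mul_eq (u k : ℝ) : Real.sign (u - k) * (u^2 - k^2) = |u - k| * (u + k) := by
  have : Real.sign (u - k) * (u - k) = |u - k| := by
    rcases lt_trichotomy (u-k) 0 with h | h | h
    · rw [Real.sign_of_neg h, abs_of_neg h]; ring
    · rw [h]; simp
    · rw [Real.sign_of_pos h, abs_of_pos h]; ring
  rw [← this]; ring

/-- `ρ^(A)` is a Kruzkov entropy solution of the Burgers equation with initial datum
`ρ̄^(A)`. -/
theorem rhoA_isEntropySolution : IsEntropySolBurgers rhoA rhoA0 := by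
  refine ⟨rhoA_meas, ⟨1, rhoA_bound⟩, rhoA0_meas, ⟨2, rhoA0_bound⟩, ?_, ?_⟩
  · intro φ hs hc
    obtain ⟨B, -, h⟩ := fullA (η := fun u => u) (q := fun u => u^2) (e := fun _ => 1) (k := 0) (C := 1)
      (by fun_prop) (by fun_prop) (by fun_prop) (by simp) (fun u _ => hasDerivAt_id u)
      (fun u _ => by simpa using hasDerivAt_pow 2 u) hs hc
    rw [h]
    simp
  · intro k φ hs hc hφ
    have hd : ∀ u, u ≠ k → HasDerivAt (fun u => |u - k|) (if u < k then -1 else 1) u := by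
      intro u hu
      have h1 : HasDerivAt (fun u : ℝ => u - k) 1 u := (hasDerivAt_id u).sub_const k
      rcases lt_or_gt_of_ne hu with h | h
      · rw [if_pos h]
        exact ((hasDerivAt_abs_neg (by linarith)).comp u h1).congr_deriv (by ring)
      · rw [if_neg (not_lt.2 h.le)]
        exact ((hasDerivAt_abs_pos (by linarith)).comp u h1).congr_deriv (by ring)
    obtain ⟨B, hB, h⟩ := fullA (η := fun u => |u - k|) (q := fun u => |u - k| * (u + k))
      (e := fun u => if u < k then -1 else 1) (k := k) (C := 1)
      (by fun_prop) (by fun_prop)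
      (Measurable.ite measurableSet_Iio measurable_const measurable_const)
      (fun u => by split_ifs <;> simp) hd
      (fun u hu => by
        have := (hd u hu).mul ((hasDerivAt_id u).add_const k)
        refine this.congr_deriv ?_
        simp only [id]
        rcases lt_or_gt_of_ne hu with h | h
        · rw [if_pos h, abs_of_neg (by linarith)]; ring
        · rw [if_neg (not_lt.2 h.le), abs_of_pos (by linarith)]; ring) hs hc
    simp_rw [sign_mul_eq]
    rw [h]
    apply intervalIntegral.integral_nonneg hB.le
    intro t _
    apply mul_nonneg _ (hφ t 0)
    have hw := wA_nonneg t 0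
    generalize wA t 0 = w at hw
    rcases abs_cases (w - k) with ⟨h1, h2⟩ | ⟨h1, h2⟩ <;>
      rcases abs_cases (-w - k) with ⟨h3, h4⟩ | ⟨h3, h4⟩ <;> rw [h1, h3] <;> nlinarith
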